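/- For all τ in the upper half-plane ℍ and all z ∈ ℂ⁴, the determinant of the 4×4 Jacobian matrix whose (i,j) entry is ∂F_i/∂z_j, where (F₁,F₂,F₃,F₄) = (K,L,M,N) as functions of z at fixed τ, equals −(1/2) · e^{πiτ} · ∏_{n=1}^∞ (1−qⁿ)¹² · ∏_{1≤i<j≤4} (zᵢ² − zⱼ²) (the factor e^{πiτ}∏_{n≥1}(1−qⁿ)¹² is the 12th power of the Dedekind eta function η(τ)). -/

import Mathlib

open MvPolynomial Complex

/-- `I2 = z1²+z2²+z3²+z4²` as a function on ℂ⁴ -/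
noncomputable def fI2 (z : Fin 4 → ℂ) : ℂ := ∑ i, z i ^ 2

/-- `I4 = Σ_{i<j} zi²zj²` as a function on ℂ⁴ -/
noncomputable def fI4 (z : Fin 4 → ℂ) : ℂ :=
  ∑ p ∈ Finset.univ.filter (fun p : Fin 4 × Fin 4 => p.1 < p.2), z p.1 ^ 2 * z p.2 ^ 2

/-- `I6 = Σ_{i<j<k} zi²zj²zk²` as a function on ℂ⁴ -/
noncomputable def fI6 (z : Fin 4 → ℂ) : ℂ :=
  ∑ p ∈ Finset.univ.filter (fun p : Fin 4 × Fin 4 × Fin 4 => p.1 < p.2.1 ∧ p.2.1 < p.2.2),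
    z p.1 ^ 2 * z p.2.1 ^ 2 * z p.2.2 ^ 2

/-- `Ĩ4 = z1z2z3z4` as a function on ℂ⁴ -/
noncomputable def fI4t (z : Fin 4 → ℂ) : ℂ := ∏ i, z i

/-- `T1 = I4/6 − I2²/24` -/
noncomputable def fT1 (z : Fin 4 → ℂ) : ℂ := fI4 z / 6 - fI2 z ^ 2 / 24

/-- `T2 = −I4/12 − Ĩ4/2 + I2²/48` -/
noncomputable def fT2 (z : Fin 4 → ℂ) : ℂ := -fI4 z / 12 - fI4t z / 2 + fI2 z ^ 2 / 48

/-- `T3 = −I4/12 + Ĩ4/2 + I2²/48` -/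
noncomputable def fT3 (z : Fin 4 → ℂ) : ℂ := -fI4 z / 12 + fI4t z / 2 + fI2 z ^ 2 / 48

/-- `θ2(τ) = Σ_{n∈ℤ} q^{(n−1/2)²/2}`, `q = e^{2πiτ}` -/
noncomputable def theta2 (τ : ℂ) : ℂ :=
  ∑' n : ℤ, Complex.exp (Real.pi * Complex.I * τ * ((n : ℂ) - 1 / 2) ^ 2)

/-- `θ3(τ) = Σ_{n∈ℤ} q^{n²/2}` -/
noncomputable def theta3 (τ : ℂ) : ℂ :=
  ∑' n : ℤ, Complex.exp (Real.pi * Complex.I * τ * (n : ℂ) ^ 2)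

/-- `θ4(τ) = Σ_{n∈ℤ} (−1)ⁿ q^{n²/2}` -/
noncomputable def theta4 (τ : ℂ) : ℂ :=
  ∑' n : ℤ, (-1 : ℂ) ^ n * Complex.exp (Real.pi * Complex.I * τ * (n : ℂ) ^ 2)

/-- `e1 = (θ3⁴+θ4⁴)/12` -/
noncomputable def e1 (τ : ℂ) : ℂ := (theta3 τ ^ 4 + theta4 τ ^ 4) / 12

/-- `e2 = (θ2⁴−θ4⁴)/12` -/
noncomputable def e2 (τ : ℂ) : ℂ := (theta2 τ ^ 4 - theta4 τ ^ 4) / 12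

/-- `e3 = (−θ2⁴−θ3⁴)/12` -/
noncomputable def e3 (τ : ℂ) : ℂ := (-theta2 τ ^ 4 - theta3 τ ^ 4) / 12

/-- `K = I2` -/
noncomputable def Kf (_τ : ℂ) (z : Fin 4 → ℂ) : ℂ := fI2 z

/-- `L = e1·T1 + e2·T2 + e3·T3` -/
noncomputable def Lf (τ : ℂ) (z : Fin 4 → ℂ) : ℂ :=
  e1 τ * fT1 z + e2 τ * fT2 z + e3 τ * fT3 z

/-- `M = 12(e1²·T1 + e2²·T2 + e3²·T3)` -/
noncomputable def Mf (τ : ℂ) (z : Fin 4 → ℂ) : ℂ :=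
  12 * (e1 τ ^ 2 * fT1 z + e2 τ ^ 2 * fT2 z + e3 τ ^ 2 * fT3 z)

/-- `N = I6/4 − I2·I4/24 + I2³/96` -/
noncomputable def Nf (_τ : ℂ) (z : Fin 4 → ℂ) : ℂ :=
  fI6 z / 4 - fI2 z * fI4 z / 24 + fI2 z ^ 3 / 96

/-- `q = e^{2πiτ}` -/
noncomputable def qc (τ : ℂ) : ℂ := Complex.exp (2 * Real.pi * Complex.I * τ)

/-- `E4(τ) = 1 + 240·Σ_{n≥1} n³qⁿ/(1−qⁿ)` -/
noncomputable def E4 (τ : ℂ) : ℂ :=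
  1 + 240 * ∑' n : ℕ, ((n : ℂ) + 1) ^ 3 * qc τ ^ (n + 1) / (1 - qc τ ^ (n + 1))

/-- `E6(τ) = 1 − 504·Σ_{n≥1} n⁵qⁿ/(1−qⁿ)` -/
noncomputable def E6 (τ : ℂ) : ℂ :=
  1 - 504 * ∑' n : ℕ, ((n : ℂ) + 1) ^ 5 * qc τ ^ (n + 1) / (1 - qc τ ^ (n + 1))

/-- `Δ = (E4³ − E6²)/1728` -/
noncomputable def Δf (τ : ℂ) : ℂ := (E4 τ ^ 3 - E6 τ ^ 2) / 1728

lemma filter_lt_fin_four :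
    Finset.univ.filter (fun p : Fin 4 × Fin 4 => p.1 < p.2) =
      {(0, 1), (0, 2), (0, 3), (1, 2), (1, 3), (2, 3)} := by decide

lemma fI2_eq (z : Fin 4 → ℂ) : fI2 z = z 0 ^ 2 + z 1 ^ 2 + z 2 ^ 2 + z 3 ^ 2 :=
  Fin.sum_univ_four _

lemma fI4_eq (z : Fin 4 → ℂ) : fI4 z = z 0 ^ 2 * z 1 ^ 2 + z 0 ^ 2 * z 2 ^ 2 + z 0 ^ 2 * z 3 ^ 2 +
    z 1 ^ 2 * z 2 ^ 2 + z 1 ^ 2 * z 3 ^ 2 + z 2 ^ 2 * z 3 ^ 2 := by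
  simp [fI4, filter_lt_fin_four, add_assoc]

lemma fI6_eq (z : Fin 4 → ℂ) : fI6 z = z 0 ^ 2 * z 1 ^ 2 * z 2 ^ 2 + z 0 ^ 2 * z 1 ^ 2 * z 3 ^ 2 +
    z 0 ^ 2 * z 2 ^ 2 * z 3 ^ 2 + z 1 ^ 2 * z 2 ^ 2 * z 3 ^ 2 := by
  have h : Finset.univ.filter
      (fun p : Fin 4 × Fin 4 × Fin 4 => p.1 < p.2.1 ∧ p.2.1 < p.2.2) =
      {(0, 1, 2), (0, 1, 3), (0, 2, 3), (1, 2, 3)} := by decide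
  simp [fI6, h, add_assoc]

lemma fI4t_eq (z : Fin 4 → ℂ) : fI4t z = z 0 * z 1 * z 2 * z 3 :=
  Fin.prod_univ_four _

/-- The linear form on `ℂ⁴` with coefficient vector `v`. -/
noncomputable def gradForm (v : Fin 4 → ℂ) : (Fin 4 → ℂ) →L[ℂ] ℂ :=
  ∑ i, v i • ContinuousLinearMap.proj i

lemma fderiv_single_of_hasFDerivAt_gradForm {f : (Fin 4 → ℂ) → ℂ} {v z : Fin 4 → ℂ}
    (h : HasFDerivAt f (gradForm v) z) (j : Fin 4) : fderiv ℂ f z (Pi.single j 1) = v j := by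
  simp [h.fderiv, gradForm, Pi.single_apply]

lemma gradForm_add (v w : Fin 4 → ℂ) : gradForm v + gradForm w = gradForm (v + w) := by
  ext x
  simp [gradForm, add_mul, Finset.sum_add_distrib]

lemma gradForm_smul (c : ℂ) (v : Fin 4 → ℂ) : c • gradForm v = gradForm (c • v) := by
  simp [gradForm, Finset.smul_sum, mul_smul]

lemma hasFDerivAt_coord (z : Fin 4 → ℂ) (i : Fin 4) :
    HasFDerivAt (fun w : Fin 4 → ℂ => w i) (gradForm (Pi.single i 1)) z := by
  have h : gradForm (Pi.single i 1) = ContinuousLinearMap.proj i := by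
    ext x
    simp only [gradForm, _root_.sum_apply, _root_.smul_apply]
    simp [Pi.single_apply]
  exact h ▸ (ContinuousLinearMap.proj (R := ℂ) (φ := fun _ : Fin 4 => ℂ) i).hasFDerivAt

lemma hasFDerivAt_fI2 (z : Fin 4 → ℂ) : HasFDerivAt fI2 (gradForm fun j => 2 * z j) z := by
  have h := hasFDerivAt_coord z
  rw [funext fI2_eq]
  refine (((((h 0).pow 2).add ((h 1).pow 2)).add ((h 2).pow 2)).add ((h 3).pow 2)).congr_fderiv ?_
  simp only [gradForm_add, gradForm_smul]
  congr 1
  ext j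
  fin_cases j <;> simp

lemma hasFDerivAt_fI4 (z : Fin 4 → ℂ) :
    HasFDerivAt fI4 (gradForm fun j => 2 * z j * (fI2 z - z j ^ 2)) z := by
  have h := hasFDerivAt_coord z
  have h2 (i j : Fin 4) := ((h i).pow 2).mul ((h j).pow 2)
  rw [funext fI4_eq]
  refine ((((((h2 0 1).add (h2 0 2)).add (h2 0 3)).add (h2 1 2)).add (h2 1 3)).add
    (h2 2 3)).congr_fderiv ?_
  simp only [gradForm_add, gradForm_smul]
  congr 1
  ext j
  fin_cases j <;> simp [fI2_eq] <;> ring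

lemma hasFDerivAt_fI6 (z : Fin 4 → ℂ) :
    HasFDerivAt fI6 (gradForm fun j => 2 * z j * (fI4 z - z j ^ 2 * (fI2 z - z j ^ 2))) z := by
  have h := hasFDerivAt_coord z
  have h3 (i j k : Fin 4) := (((h i).pow 2).mul ((h j).pow 2)).mul ((h k).pow 2)
  rw [funext fI6_eq]
  refine ((((h3 0 1 2).add (h3 0 1 3)).add (h3 0 2 3)).add (h3 1 2 3)).congr_fderiv ?_
  simp only [gradForm_add, gradForm_smul]
  congr 1
  ext j
  fin_cases j <;> simp [fI2_eq, fI4_eq] <;> ring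

lemma hasFDerivAt_fI4t (z : Fin 4 → ℂ) :
    HasFDerivAt fI4t (gradForm ![z 1 * z 2 * z 3, z 0 * z 2 * z 3, z 0 * z 1 * z 3,
      z 0 * z 1 * z 2]) z := by
  have h := hasFDerivAt_coord z
  rw [funext fI4t_eq]
  refine ((((h 0).mul (h 1)).mul (h 2)).mul (h 3)).congr_fderiv ?_
  simp only [gradForm_add, gradForm_smul]
  congr 1
  ext j
  fin_cases j <;> simp <;> ring

/-- The gradient at `z` of `a * (I4/4 − I2²/16) + b * Ĩ4`. -/
noncomputable def quarticGrad (a b : ℂ) (z : Fin 4 → ℂ) (j : Fin 4) : ℂ :=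
  a * (z j * (fI2 z - 2 * z j ^ 2) / 4) +
    b * ![z 1 * z 2 * z 3, z 0 * z 2 * z 3, z 0 * z 1 * z 3, z 0 * z 1 * z 2] j

lemma hasFDerivAt_quartic (a b : ℂ) (z : Fin 4 → ℂ) :
    HasFDerivAt (fun w => a * (fI4 w / 4 - fI2 w ^ 2 / 16) + b * fI4t w)
      (gradForm (quarticGrad a b z)) z := by
  have h := (((hasFDerivAt_fI4 z).const_mul (a / 4)).add
    (((hasFDerivAt_fI2 z).pow 2).const_mul (-a / 16))).add ((hasFDerivAt_fI4t z).const_mul b)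
  refine (h.congr_fderiv ?_).congr_of_eventuallyEq (.of_forall fun w => ?_)
  · simp only [gradForm_add, gradForm_smul]
    congr 1
    ext j
    fin_cases j <;> simp [quarticGrad] <;> ring
  · simp only [Pi.add_apply]
    ring

/-- The gradient of `N` at `z`. -/
noncomputable def sexticGrad (z : Fin 4 → ℂ) (j : Fin 4) : ℂ :=
  2 * z j * (fI4 z / 4 - z j ^ 2 * (fI2 z - z j ^ 2) / 4
    - fI4 z / 24 - fI2 z * (fI2 z - z j ^ 2) / 24 + fI2 z ^ 2 / 32)

lemma hasFDerivAt_Nf (τ : ℂ) (z : Fin 4 → ℂ) :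
    HasFDerivAt (Nf τ) (gradForm (sexticGrad z)) z := by
  have h := (((hasFDerivAt_fI6 z).mul_const (1 / 4 : ℂ)).add
    (((hasFDerivAt_fI2 z).mul (hasFDerivAt_fI4 z)).mul_const (-1 / 24 : ℂ))).add
    (((hasFDerivAt_fI2 z).pow 3).mul_const (1 / 96 : ℂ))
  refine (h.congr_fderiv ?_).congr_of_eventuallyEq (.of_forall fun w => ?_)
  · simp only [gradForm_add, gradForm_smul]
    congr 1
    ext j
    simp [sexticGrad]
    ring
  · simp [Nf]
    ring

lemma e1_add_e2_add_e3 (τ : ℂ) : e1 τ + e2 τ + e3 τ = 0 := by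
  simp only [e1, e2, e3]
  ring

lemma Lf_eq (τ : ℂ) : Lf τ = fun w =>
    e1 τ * (fI4 w / 4 - fI2 w ^ 2 / 16) + (e3 τ - e2 τ) / 2 * fI4t w := by
  ext w
  simp only [Lf, fT1, fT2, fT3]
  linear_combination (-fI4 w / 12 + fI2 w ^ 2 / 48) * e1_add_e2_add_e3 τ

lemma Mf_eq (τ : ℂ) : Mf τ = fun w =>
    (8 * e1 τ ^ 2 - 4 * (e2 τ ^ 2 + e3 τ ^ 2)) * (fI4 w / 4 - fI2 w ^ 2 / 16) +
      6 * (e3 τ ^ 2 - e2 τ ^ 2) * fI4t w := by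
  ext w
  simp only [Mf, fT1, fT2, fT3]
  ring

/-- The Jacobian determinant factors through the differences of `e1, e2, e3`. -/
lemma jacobian_det_eq (τ : ℂ) (z : Fin 4 → ℂ) :
    (Matrix.of fun i j : Fin 4 =>
        fderiv ℂ (![Kf τ, Lf τ, Mf τ, Nf τ] i) z (Pi.single j 1)).det
      = 2 * ((e1 τ - e3 τ) * (e2 τ - e3 τ) * (e2 τ - e1 τ))
          * ∏ p ∈ Finset.univ.filter (fun p : Fin 4 × Fin 4 => p.1 < p.2),
              (z p.1 ^ 2 - z p.2 ^ 2) := by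
  have hM : (Matrix.of fun i j : Fin 4 =>
        fderiv ℂ (![Kf τ, Lf τ, Mf τ, Nf τ] i) z (Pi.single j 1)) = Matrix.of ![
      fun j => 2 * z j,
      quarticGrad (e1 τ) ((e3 τ - e2 τ) / 2) z,
      quarticGrad (8 * e1 τ ^ 2 - 4 * (e2 τ ^ 2 + e3 τ ^ 2)) (6 * (e3 τ ^ 2 - e2 τ ^ 2)) z,
      sexticGrad z] := by
    ext i j
    fin_cases i
    · exact fderiv_single_of_hasFDerivAt_gradForm (hasFDerivAt_fI2 z) j
    · exact fderiv_single_of_hasFDerivAt_gradForm (Lf_eq τ ▸ hasFDerivAt_quartic _ _ z) j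
    · exact fderiv_single_of_hasFDerivAt_gradForm (Mf_eq τ ▸ hasFDerivAt_quartic _ _ z) j
    · exact fderiv_single_of_hasFDerivAt_gradForm (hasFDerivAt_Nf τ z) j
  have he : e3 τ = -e1 τ - e2 τ := by linear_combination e1_add_e2_add_e3 τ
  rw [hM, filter_lt_fin_four, he]
  generalize e1 τ = a
  generalize e2 τ = b
  simp [Matrix.det_succ_row_zero, Fin.sum_univ_succ, Fin.succAbove, quarticGrad, sexticGrad, fI2_eq, fI4_eq]
  ring

section theta

open UpperHalfPlane hiding I
open Filter ModularForm MatrixGroups Real Topology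

lemma theta3_eq (τ : ℂ) : theta3 τ = jacobiTheta₂ 0 τ :=
  tsum_congr fun n => by
    rw [jacobiTheta₂_term]
    ring_nf

lemma theta4_eq (τ : ℂ) : theta4 τ = jacobiTheta₂ (1 / 2) τ :=
  tsum_congr fun n => by
    have h : cexp (π * I) ^ n = (-1 : ℂ) ^ n := by rw [exp_pi_mul_I]
    rw [jacobiTheta₂_term, ← h, ← exp_int_mul, ← Complex.exp_add]
    ring_nf

lemma theta2_eq (τ : ℂ) : theta2 τ = cexp (π * I * τ / 4) * jacobiTheta₂ (τ / 2) τ := by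
  rw [theta2, jacobiTheta₂, ← tsum_mul_left, ← (Equiv.addRight (1 : ℤ)).tsum_eq]
  refine tsum_congr fun n => ?_
  rw [jacobiTheta₂_term, ← Complex.exp_add]
  simp only [Equiv.coe_addRight]
  push_cast
  ring_nf

lemma theta3_add_one (τ : ℂ) : theta3 (τ + 1) = theta4 τ :=
  tsum_congr fun n => by
    have h : cexp (π * I * n ^ 2) = (-1 : ℂ) ^ n := by
      rw [← exp_pi_mul_I, ← exp_int_mul, exp_eq_exp_iff_exists_int]
      obtain ⟨k, hk⟩ := Int.even_mul_pred_self n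
      refine ⟨k, ?_⟩
      have hk' : (n : ℂ) * (n - 1) = k + k := by exact_mod_cast hk
      linear_combination π * I * hk'
    rw [← h, ← Complex.exp_add]
    ring_nf

lemma theta4_add_one (τ : ℂ) : theta4 (τ + 1) = theta3 τ := by
  rw [← theta3_add_one, add_assoc, one_add_one_eq_two, theta3_eq, theta3_eq,
    jacobiTheta₂_add_right]

lemma theta2_add_one_pow_four (τ : ℂ) : theta2 (τ + 1) ^ 4 = -theta2 τ ^ 4 := by
  have h : theta2 (τ + 1) = cexp (π * I / 4) * theta2 τ := by
    rw [theta2, theta2, ← tsum_mul_left]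
    refine tsum_congr fun n => ?_
    rw [← Complex.exp_add, exp_eq_exp_iff_exists_int]
    obtain ⟨k, hk⟩ := Int.even_mul_pred_self n
    refine ⟨k, ?_⟩
    have hk' : (n : ℂ) * (n - 1) = k + k := by exact_mod_cast hk
    linear_combination π * I * hk'
  have h4 : cexp (π * I / 4) ^ 4 = -1 := by
    rw [← exp_pi_mul_I, ← Complex.exp_nat_mul]
    push_cast
    ring_nf
  rw [h, mul_pow, h4, neg_one_mul]

lemma one_div_cpow_half_pow_four (τ : ℂ) : (1 / (-I * τ) ^ (1 / 2 : ℂ)) ^ 4 = -(1 / τ ^ 2) := by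
  rw [div_pow, ← cpow_nat_mul]
  norm_num [mul_pow]

lemma jacobiTheta₂_pow_four (z τ : ℂ) : jacobiTheta₂ z τ ^ 4 =
    -(1 / τ ^ 2) * (cexp (-π * I * z ^ 2 / τ) * jacobiTheta₂ (z / τ) (-1 / τ)) ^ 4 := by
  rw [jacobiTheta₂_functional_equation, mul_assoc, mul_pow, one_div_cpow_half_pow_four]

lemma theta3_neg_one_div_pow_four {τ : ℂ} (hτ : τ ≠ 0) :
    theta3 (-1 / τ) ^ 4 = -τ ^ 2 * theta3 τ ^ 4 := by
  rw [theta3_eq, theta3_eq, jacobiTheta₂_pow_four 0 τ]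
  simp
  field_simp

lemma theta4_neg_one_div_pow_four {τ : ℂ} (hτ : τ ≠ 0) :
    theta4 (-1 / τ) ^ 4 = -τ ^ 2 * theta2 τ ^ 4 := by
  have h : -π * I * (τ / 2) ^ 2 / τ = -(π * I * τ / 4) := by field_simp; ring
  rw [theta4_eq, theta2_eq, mul_pow _ (jacobiTheta₂ _ _), jacobiTheta₂_pow_four (τ / 2) τ, h,
    Complex.exp_neg, div_right_comm, div_self hτ]
  field_simp

lemma theta2_neg_one_div_pow_four {τ : ℂ} (hτ : τ ≠ 0) :
    theta2 (-1 / τ) ^ 4 = -τ ^ 2 * theta4 τ ^ 4 := by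
  have h : π * I * (-1 / τ) / 4 = -π * I * (1 / 2) ^ 2 / τ := by ring
  have h' : -1 / τ / 2 = -(1 / 2 / τ) := by ring
  rw [theta4_eq, theta2_eq, jacobiTheta₂_pow_four (1 / 2) τ, h, h', jacobiTheta₂_neg_left]
  field_simp

lemma differentiableAt_theta3 {τ : ℂ} (hτ : 0 < τ.im) : DifferentiableAt ℂ theta3 τ := by
  rw [funext theta3_eq]
  exact differentiableAt_jacobiTheta₂_snd 0 hτ

lemma differentiableAt_theta4 {τ : ℂ} (hτ : 0 < τ.im) : DifferentiableAt ℂ theta4 τ := by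
  rw [funext theta4_eq]
  exact differentiableAt_jacobiTheta₂_snd _ hτ

lemma differentiableAt_theta2 {τ : ℂ} (hτ : 0 < τ.im) : DifferentiableAt ℂ theta2 τ := by
  rw [funext theta2_eq]
  have h : DifferentiableAt ℂ (fun t => jacobiTheta₂ (t / 2) t) τ :=
    (hasFDerivAt_jacobiTheta₂ (τ / 2) hτ).differentiableAt.comp (f := fun t : ℂ => (t / 2, t)) τ
      (by fun_prop)
  fun_prop

lemma tendsto_theta3 : Tendsto (fun τ : ℍ => theta3 τ) atImInfty (𝓝 1) := by
  have h : Tendsto (fun y : ℝ => rexp (-π * y)) atTop (𝓝 0) :=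
    tendsto_exp_atBot.comp (tendsto_id.const_mul_atTop_of_neg (by simp [pi_pos]))
  have h1 : Tendsto (fun τ => jacobiTheta τ - 1) (comap im atTop) (𝓝 0) :=
    isBigO_at_im_infty_jacobiTheta_sub_one.trans_tendsto (h.comp tendsto_comap)
  have h2 := (h1.comp tendsto_coe_atImInfty).add_const 1
  simpa [Function.comp_def, jacobiTheta_eq_jacobiTheta₂, ← theta3_eq] using h2

lemma tendsto_theta4 : Tendsto (fun τ : ℍ => theta4 τ) atImInfty (𝓝 1) := by
  have h : Tendsto (fun τ : ℍ => (1 : ℝ) +ᵥ τ) atImInfty atImInfty := by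
    rw [atImInfty, tendsto_comap_iff]
    exact tendsto_comap.congr fun τ => by simp
  refine (tendsto_theta3.comp h).congr fun τ => ?_
  simp [add_comm (1 : ℂ), theta3_add_one]

lemma tendsto_jacobiTheta₂_half :
    Tendsto (fun τ : ℍ => jacobiTheta₂ (τ / 2) τ) atImInfty (𝓝 2) := by
  have hnorm (n : ℤ) (τ : ℂ) :
      ‖jacobiTheta₂_term n (τ / 2) τ‖ = rexp (-π * (n * (n + 1) : ℤ) * τ.im) := by
    rw [norm_jacobiTheta₂_term, div_ofNat_im]
    push_cast
    ring_nf
  have hn (n : ℤ) : 0 ≤ n * (n + 1) := by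
    rcases le_or_gt 0 n with h | h <;> nlinarith
  have h := tendsto_tsum_of_dominated_convergence (𝓕 := atImInfty)
    (f := fun (τ : ℍ) n => jacobiTheta₂_term n (τ / 2) τ)
    (g := fun n => if n ∈ ({0, -1} : Finset ℤ) then 1 else 0)
    (bound := fun n => ‖jacobiTheta₂_term n (I / 2) I‖)
    ((summable_jacobiTheta₂_term_iff _ _).mpr (by simp)).norm ?_ ?_
  · rw [tsum_eq_sum (s := ({0, -1} : Finset ℤ)) fun n hn => if_neg hn] at h
    norm_num at h
    exact h
  · intro n
    split_ifs with h
    · refine tendsto_const_nhds.congr fun τ => ?_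
      simp only [Finset.mem_insert, Finset.mem_singleton] at h
      rcases h with rfl | rfl <;> simp [jacobiTheta₂_term]
      symm
      convert Complex.exp_zero using 2
      ring
    · rw [tendsto_zero_iff_norm_tendsto_zero]
      simp only [hnorm]
      have hpos : 0 < n * (n + 1) := by
        simp only [Finset.mem_insert, Finset.mem_singleton, not_or] at h
        refine lt_of_le_of_ne (hn n) (Ne.symm (mul_ne_zero h.1 fun h' => h.2 (by omega)))
      have hpos' : (0 : ℝ) < (n * (n + 1) : ℤ) := by exact_mod_cast hpos
      exact tendsto_exp_atBot.comp
        (tendsto_comap.const_mul_atTop_of_neg (by nlinarith [pi_pos]))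
  · have h1 : ∀ᶠ τ : ℍ in atImInfty, 1 ≤ τ.im := tendsto_comap.eventually_ge_atTop 1
    filter_upwards [h1] with τ hτ n
    rw [hnorm, hnorm, Real.exp_le_exp]
    have hn' : (0 : ℝ) ≤ (n * (n + 1) : ℤ) := by exact_mod_cast hn n
    simp only [Complex.I_im]
    have := mul_nonneg pi_pos.le hn'
    have := coe_im τ
    nlinarith

/-- The level one cusp form attached to a function which is holomorphic on the upper half-plane,
transforms correctly under the generators `T` and `S`, and vanishes at `i∞`. -/
noncomputable def levelOneCuspForm (k : ℤ) (f : ℂ → ℂ)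
    (hd : ∀ τ : ℂ, 0 < τ.im → DifferentiableAt ℂ f τ)
    (hT : ∀ τ : ℂ, 0 < τ.im → f (τ + 1) = f τ)
    (hS : ∀ τ : ℂ, 0 < τ.im → f (-1 / τ) = τ ^ k * f τ)
    (h0 : Tendsto (fun τ : ℍ => f τ) atImInfty (𝓝 0)) : CuspForm 𝒮ℒ k :=
  have slash (γ : SL(2, ℤ)) : (fun τ : ℍ => f τ) ∣[k] γ = fun τ : ℍ => f τ := by
    refine SlashInvariantForm.slash_action_generators_SL2Z ?_ ?_ γ
    · ext τ
      rw [SL_slash_apply, modular_S_smul, ModularGroup.denom_S, zpow_neg]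
      have hτ : (τ : ℂ) ^ k ≠ 0 := zpow_ne_zero _ τ.ne_zero
      have h : (-(τ : ℂ))⁻¹ = -1 / τ := by rw [inv_neg, neg_div, one_div]
      simp only [h, hS τ τ.im_pos]
      field_simp
    · ext τ
      have hdenom : denom (ModularGroup.T : SL(2, ℤ)) τ = 1 := by
        simp [ModularGroup.denom_apply, ModularGroup.coe_T]
      rw [SL_slash_apply, modular_T_smul, hdenom, one_zpow, mul_one, coe_vadd, ofReal_one,
        add_comm, hT τ τ.im_pos]
  { toFun := fun τ => f τ
    slash_action_eq' := by
      rintro _ ⟨γ, rfl⟩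
      exact slash γ
    holo' := by
      rw [UpperHalfPlane.mdifferentiable_iff]
      refine .congr (fun τ hτ => (hd τ hτ).differentiableWithinAt) fun τ hτ => ?_
      simp [ofComplex_apply_of_im_pos hτ]
    zero_at_cusps' := fun hc => by
      rw [Subgroup.IsArithmetic.isCusp_iff_isCusp_SL2Z] at hc
      rw [OnePoint.isZeroAt_iff_forall_SL2Z hc]
      intro γ _
      rw [slash]
      exact h0 }

lemma tendsto_theta2 : Tendsto (fun τ : ℍ => theta2 τ) atImInfty (𝓝 0) := by
  have h : Tendsto (fun τ : ℍ => cexp (π * I * τ / 4)) atImInfty (𝓝 0) :=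
    (qParam_tendsto_atImInfty (h := 8) (by norm_num)).congr fun τ => by
      rw [Function.Periodic.qParam]
      congr 1
      push_cast
      ring
  simpa [theta2_eq] using h.mul tendsto_jacobiTheta₂_half

lemma im_pos_ne_zero {τ : ℂ} (hτ : 0 < τ.im) : τ ≠ 0 := by
  rintro rfl
  simp at hτ

/-- Jacobi's identity between the fourth powers of the theta constants. -/
lemma theta3_pow_four {τ : ℂ} (hτ : 0 < τ.im) :
    theta3 τ ^ 4 = theta2 τ ^ 4 + theta4 τ ^ 4 := by
  let g : CuspForm 𝒮ℒ 4 := levelOneCuspForm 4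
    (fun τ => (theta3 τ ^ 4 - theta2 τ ^ 4 - theta4 τ ^ 4) ^ 2)
    (fun τ hτ => by
      have := differentiableAt_theta2 hτ
      have := differentiableAt_theta3 hτ
      have := differentiableAt_theta4 hτ
      fun_prop)
    (fun τ _ => by
      rw [theta3_add_one, theta4_add_one, theta2_add_one_pow_four]
      ring)
    (fun τ hτ => by
      have h := im_pos_ne_zero hτ
      rw [theta3_neg_one_div_pow_four h, theta4_neg_one_div_pow_four h,
        theta2_neg_one_div_pow_four h, zpow_ofNat]
      ring)
    (by simpa using (((tendsto_theta3.pow 4).sub (tendsto_theta2.pow 4)).sub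
      (tendsto_theta4.pow 4)).pow 2)
  have hg : g = 0 :=
    rank_zero_iff_forall_zero.mp (CuspForm.rank_eq_zero_of_weight_lt_twelve (by norm_num)) g
  have h : (theta3 τ ^ 4 - theta2 τ ^ 4 - theta4 τ ^ 4) ^ 2 = 0 :=
    DFunLike.congr_fun hg (⟨τ, hτ⟩ : ℍ)
  linear_combination pow_eq_zero_iff (two_ne_zero) |>.mp h

lemma eta_pow_twelve (τ : ℂ) :
    η τ ^ 12 = cexp (π * I * τ) * (∏' n : ℕ, (1 - qc τ ^ (n + 1))) ^ 12 := by
  rw [ModularForm.eta, mul_pow, Function.Periodic.qParam, ← Complex.exp_nat_mul]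
  simp only [eta_q_eq_pow, qc]
  congr 2
  push_cast
  ring

lemma eta_add_one_pow_twelve (τ : ℂ) : η (τ + 1) ^ 12 = -η τ ^ 12 := by
  have h : qc (τ + 1) = qc τ := by
    rw [qc, mul_add, mul_one, Complex.exp_add, exp_two_pi_mul_I, mul_one, qc]
  rw [eta_pow_twelve, eta_pow_twelve, h, mul_add, mul_one, Complex.exp_add, exp_pi_mul_I]
  ring

lemma eta_neg_one_div_pow_twelve {τ : ℂ} (hτ : 0 < τ.im) :
    η (-1 / τ) ^ 12 = -τ ^ 6 * η τ ^ 12 := by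
  have hsqrt {z : ℂ} (hz : z ≠ 0) : Complex.sqrt z ^ 12 = z ^ 6 := by
    rw [sqrt_eq_exp hz, ← Complex.exp_nat_mul]
    conv_rhs => rw [← exp_log hz, ← Complex.exp_nat_mul]
    push_cast
    ring_nf
  have h : η (-1 / τ) = (Complex.sqrt I)⁻¹ * (Complex.sqrt τ * η τ) := eta_comp_eq_csqrt_I_inv hτ
  have hI : I ^ 6 = -1 := by rw [show 6 = 4 + 2 from rfl, pow_add, I_pow_four, I_sq, one_mul]
  rw [h, mul_pow, mul_pow, inv_pow, hsqrt I_ne_zero, hsqrt (im_pos_ne_zero hτ), hI]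
  ring

lemma tendsto_tprod_one_sub_qc_pow :
    Tendsto (fun τ : ℍ => ∏' n : ℕ, (1 - qc τ ^ (n + 1))) atImInfty (𝓝 1) := by
  have h : Tendsto (fun q : ℂ => ∏' n : ℕ, (1 - q ^ (n + 1))) (𝓝 0) (𝓝 1) := by
    simpa [ContinuousAt] using (differentiableOn_tprod_one_sub_pow.differentiableAt
      (Metric.ball_mem_nhds 0 one_pos)).continuousAt
  refine (h.comp (qParam_tendsto_atImInfty one_pos)).congr fun τ => ?_
  simp [Function.Periodic.qParam, qc]

lemma tendsto_eta_pow_twelve : Tendsto (fun τ : ℍ => η τ ^ 12) atImInfty (𝓝 0) := by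
  have h : Tendsto (fun τ : ℍ => cexp (π * I * τ)) atImInfty (𝓝 0) :=
    (qParam_tendsto_atImInfty (h := 2) (by norm_num)).congr fun τ => by
      rw [Function.Periodic.qParam]
      congr 1
      push_cast
      ring
  simpa [eta_pow_twelve] using h.mul (tendsto_tprod_one_sub_qc_pow.pow 12)

/-- The product formula for the theta constants, in the form `(θ₂ θ₃ θ₄)⁴ = (2 η³)⁴`. -/
lemma theta_mul_pow_four {τ : ℂ} (hτ : 0 < τ.im) :
    theta2 τ ^ 4 * theta3 τ ^ 4 * theta4 τ ^ 4 = 16 * η τ ^ 12 := by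
  let g : CuspForm 𝒮ℒ 12 := levelOneCuspForm 12
    (fun τ => theta2 τ ^ 4 * theta3 τ ^ 4 * theta4 τ ^ 4 * η τ ^ 12)
    (fun τ hτ => by
      have := differentiableAt_theta2 hτ
      have := differentiableAt_theta3 hτ
      have := differentiableAt_theta4 hτ
      have := differentiableAt_eta_of_mem_upperHalfPlaneSet hτ
      fun_prop)
    (fun τ _ => by
      rw [theta3_add_one, theta4_add_one, theta2_add_one_pow_four, eta_add_one_pow_twelve]
      ring)
    (fun τ hτ => by
      have h := im_pos_ne_zero hτ
      rw [theta3_neg_one_div_pow_four h, theta4_neg_one_div_pow_four h,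
        theta2_neg_one_div_pow_four h, eta_neg_one_div_pow_twelve hτ, zpow_ofNat]
      ring)
    (by simpa using (((tendsto_theta2.pow 4).mul (tendsto_theta3.pow 4)).mul
      (tendsto_theta4.pow 4)).mul tendsto_eta_pow_twelve)
  obtain ⟨c, hc⟩ := CuspForm.exists_smul_discriminant_of_weight_eq_twelve g
  have hprod (τ : ℍ) : c * η τ ^ 12 = theta2 τ ^ 4 * theta3 τ ^ 4 * theta4 τ ^ 4 := by
    have h : c * η τ ^ 24 = theta2 τ ^ 4 * theta3 τ ^ 4 * theta4 τ ^ 4 * η τ ^ 12 :=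
      DFunLike.congr_fun hc τ
    refine mul_right_cancel₀ (pow_ne_zero 12 (eta_ne_zero τ.im_pos)) ?_
    linear_combination h
  have hlim := (tendsto_tprod_one_sub_qc_pow.pow 12).const_mul c
  have hlim' := ((tendsto_jacobiTheta₂_half.pow 4).mul (tendsto_theta3.pow 4)).mul
    (tendsto_theta4.pow 4)
  have hc' : c * 1 ^ 12 = 2 ^ 4 * 1 ^ 4 * 1 ^ 4 := by
    refine tendsto_nhds_unique hlim (hlim'.congr fun τ => ?_)
    have hexp : cexp (π * I * τ / 4) ^ 4 = cexp (π * I * τ) := by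
      rw [← Complex.exp_nat_mul]
      push_cast
      ring_nf
    refine mul_left_cancel₀ (Complex.exp_ne_zero (π * I * τ)) ?_
    have h := hprod τ
    rw [theta2_eq, mul_pow, hexp, eta_pow_twelve] at h
    linear_combination -h
  rw [← hprod ⟨τ, hτ⟩, show c = 16 by linear_combination hc']

lemma norm_qc_lt_one {τ : ℂ} (hτ : 0 < τ.im) : ‖qc τ‖ < 1 :=
  norm_exp_two_pi_I_lt_one ⟨τ, hτ⟩

end theta

/-- For all `τ ∈ ℍ` and `z ∈ ℂ⁴`, the Jacobian determinant of `(K,L,M,N)` with respect to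
`(z1,z2,z3,z4)` equals `−(1/2)·e^{πiτ}·∏_{n≥1}(1−qⁿ)¹²·∏_{i<j}(zᵢ²−zⱼ²)`. -/
theorem stmt_1 (τ : ℂ) (hτ : 0 < τ.im) (z : Fin 4 → ℂ) :
    (Matrix.of fun i j : Fin 4 =>
        fderiv ℂ (![Kf τ, Lf τ, Mf τ, Nf τ] i) z (Pi.single j 1)).det
      = -(1 / 2) * Complex.exp (Real.pi * Complex.I * τ)
          * (∏' n : ℕ, (1 - qc τ ^ (n + 1)) ^ 12)
          * ∏ p ∈ Finset.univ.filter (fun p : Fin 4 × Fin 4 => p.1 < p.2),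
              (z p.1 ^ 2 - z p.2 ^ 2) := by
  have hmul := ModularForm.multipliable_one_sub_pow (norm_qc_lt_one hτ)
  have hJ := theta3_pow_four hτ
  have hF := theta_mul_pow_four hτ
  rw [eta_pow_twelve] at hF
  have h1 : e1 τ - e3 τ = theta3 τ ^ 4 / 4 := by
    rw [e1, e3]
    linear_combination -hJ / 12
  have h2 : e2 τ - e3 τ = theta2 τ ^ 4 / 4 := by
    rw [e2, e3]
    linear_combination hJ / 12
  have h3 : e2 τ - e1 τ = -(theta4 τ ^ 4 / 4) := by
    rw [e1, e2]
    linear_combination -hJ / 12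
  rw [jacobian_det_eq, hmul.tprod_pow, h1, h2, h3]
  congr 1
  linear_combination -hF / 32
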